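/- Let A ∈ ℝ_+^{m×n×p} be nonnegative, let I ⊆ {1,…,m} with |I| = r1 and J ⊆ {1,…,n} with |J| = r2, and let G ∈ ℝ^{r2×r1×p} satisfy A_{IJ:} * G * A_{IJ:} = A_{IJ:} together with the t-CUR identity A = A_{:J:} * G * A_{I::}. Denote by I^c and J^c the complements of I and J. If the tensors A_{I^c J:} * G and G * A_{I J^c:} are both entrywise nonnegative, then A is co-(r1,r2)-separable with core A_{IJ:}. -/

import Mathlib

open Matrix BigOperators Kronecker

namespace CoSepNTF

noncomputable section

variable {p : ℕ}

/-- The t-product of third-order tensors, represented by their `Fin p`-indexed frontal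
slices: `(A * B)_{::s} = ∑ t, A_{::(s-t mod p)} ⬝ B_{::t}`, which is exactly
`fold (bcirc A ⬝ unfold B)`. -/
def tprod {α β γ : Type*} [Fintype β] (A : Fin p → Matrix α β ℝ)
    (B : Fin p → Matrix β γ ℝ) : Fin p → Matrix α γ ℝ :=
  fun s => ∑ t : Fin p, A (s - t) * B t

/-- The identity tensor: first frontal slice the identity, other slices zero. -/
def tId (n p : ℕ) [NeZero p] : Fin p → Matrix (Fin n) (Fin n) ℝ :=
  fun k => if k = 0 then 1 else 0

/-- Tensor transpose: `(Aᵀ)_{::k} = (A_{::(p-k+2)})ᵀ` (1-based), i.e. slice `-k` (0-based). -/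
def tT {α β : Type*} [NeZero p] (A : Fin p → Matrix α β ℝ) : Fin p → Matrix β α ℝ :=
  fun k => (A (-k))ᵀ

/-- A tensor is nonnegative if all its entries are nonnegative. -/
def Nonneg {α β : Type*} (A : Fin p → Matrix α β ℝ) : Prop := ∀ k i j, 0 ≤ A k i j

/-- Horizontal subtensor `A_{I::}` given by a row-selection map `ι`. -/
def rsub {α α' β : Type*} (ι : α' → α) (A : Fin p → Matrix α β ℝ) : Fin p → Matrix α' β ℝ :=
  fun k => (A k).submatrix ι id

/-- Lateral subtensor `A_{:J:}` given by a column-selection map `κ`. -/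
def csub {α β β' : Type*} (κ : β' → β) (A : Fin p → Matrix α β ℝ) : Fin p → Matrix α β' ℝ :=
  fun k => (A k).submatrix id κ

/-- Subtensor `A_{IJ:}`. -/
def coreSub {α α' β β' : Type*} (ι : α' → α) (κ : β' → β) (A : Fin p → Matrix α β ℝ) :
    Fin p → Matrix α' β' ℝ := fun k => (A k).submatrix ι κ

/-- `A` is co-(r1,r2)-separable with core `A_{IJ:}` for the index sets given by `ι, κ`. -/
def CoseparableWithCore {m n r1 r2 : ℕ} [NeZero p] (ι : Fin r1 → Fin m) (κ : Fin r2 → Fin n)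
    (A : Fin p → Matrix (Fin m) (Fin n) ℝ) : Prop :=
  ∃ (P1 : Fin p → Matrix (Fin m) (Fin r1) ℝ) (P2 : Fin p → Matrix (Fin r2) (Fin n) ℝ),
    Nonneg P1 ∧ Nonneg P2 ∧ rsub ι P1 = tId r1 p ∧ csub κ P2 = tId r2 p ∧
    A = tprod (tprod P1 (coreSub ι κ A)) P2

/-- `A` is co-(r1,r2)-separable. -/
def Coseparable {m n : ℕ} [NeZero p] (r1 r2 : ℕ) (A : Fin p → Matrix (Fin m) (Fin n) ℝ) : Prop :=
  ∃ (ι : Fin r1 → Fin m) (κ : Fin r2 → Fin n),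
    Function.Injective ι ∧ Function.Injective κ ∧ CoseparableWithCore ι κ A

/-- A permutation tensor: first frontal slice a permutation matrix, other slices zero. -/
def IsPermTensor {n : ℕ} [NeZero p] (Q : Fin p → Matrix (Fin n) (Fin n) ℝ) : Prop :=
  (∃ σ : Equiv.Perm (Fin n), Q 0 = σ.permMatrix ℝ) ∧ ∀ k, k ≠ 0 → Q k = 0

/-- 2×2 block tensor `[[A11, A12],[A21, A22]]` of size `m × n × p` (where `r1 ≤ m`, `r2 ≤ n`),
formed by block concatenation of each frontal slice. -/
def blockT {m n r1 r2 : ℕ} (hm : r1 ≤ m) (hn : r2 ≤ n)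
    (A11 : Fin p → Matrix (Fin r1) (Fin r2) ℝ)
    (A12 : Fin p → Matrix (Fin r1) (Fin (n - r2)) ℝ)
    (A21 : Fin p → Matrix (Fin (m - r1)) (Fin r2) ℝ)
    (A22 : Fin p → Matrix (Fin (m - r1)) (Fin (n - r2)) ℝ) :
    Fin p → Matrix (Fin m) (Fin n) ℝ :=
  fun k => (Matrix.fromBlocks (A11 k) (A12 k) (A21 k) (A22 k)).submatrix
    (fun i => finSumFinEquiv.symm (Fin.cast (Nat.add_sub_cancel' hm).symm i))
    (fun j => finSumFinEquiv.symm (Fin.cast (Nat.add_sub_cancel' hn).symm j))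

/-- The block circulant matrix of a tensor: block `(s,t)` is `A_{::((s-t) mod p)}`. -/
def bcirc {α β : Type*} (A : Fin p → Matrix α β ℝ) : Matrix (Fin p × α) (Fin p × β) ℝ :=
  Matrix.of fun si tj => A (si.1 - tj.1) si.2 tj.2

/-- The unfolding of a tensor into a block-column matrix. -/
def unfoldT {α β : Type*} (A : Fin p → Matrix α β ℝ) : Matrix (Fin p × α) β ℝ :=
  Matrix.of fun ki j => A ki.1 ki.2 j

/-- Squared Frobenius norm of a real tensor. -/
def frobSq {α β : Type*} [Fintype α] [Fintype β] (A : Fin p → Matrix α β ℝ) : ℝ :=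
  ∑ k, ∑ i, ∑ j, (A k i j) ^ 2

/-- Squared Frobenius norm of a complex tensor. -/
def frobSqC {α β : Type*} [Fintype α] [Fintype β] (A : Fin p → Matrix α β ℂ) : ℝ :=
  ∑ k, ∑ i, ∑ j, ‖A k i j‖ ^ 2

/-- Squared Frobenius norm of a real matrix. -/
def matFrobSq {α β : Type*} [Fintype α] [Fintype β] (M : Matrix α β ℝ) : ℝ :=
  ∑ i, ∑ j, (M i j) ^ 2

/-- The discrete Fourier transform of a tensor along the third dimension:
`Â_{::k} = ∑ j, ω_p^(jk) A_{::j}` with `ω_p = exp(-2πi/p)`. -/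
def fft {α β : Type*} (A : Fin p → Matrix α β ℝ) : Fin p → Matrix α β ℂ :=
  fun k => ∑ j : Fin p,
    (Complex.exp (-2 * (Real.pi : ℂ) * Complex.I / (p : ℂ)) ^ ((j : ℕ) * (k : ℕ))) •
      (A j).map Complex.ofReal

/-- The spectral (ℓ²-operator) norm of a complex matrix. -/
def specNorm {α β : Type*} [Fintype α] [Fintype β] [DecidableEq β] (M : Matrix α β ℂ) : ℝ :=
  ‖LinearMap.toContinuousLinearMap (Matrix.toEuclideanLin M)‖

/-- The tensor spectral norm: `‖A‖₂ = max_k ‖Â_{::k}‖₂`. -/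
def tSpecNorm {α β : Type*} [Fintype α] [Fintype β] [DecidableEq β]
    (A : Fin p → Matrix α β ℝ) : ℝ :=
  ⨆ k, specNorm (fft A k)

/-- The unitary DFT matrix `F_p = (1/√p)(ω_p^{jk})`. -/
def dftMatrix (p : ℕ) : Matrix (Fin p) (Fin p) ℂ :=
  Matrix.of fun j k =>
    (((Real.sqrt p)⁻¹ : ℝ) : ℂ) *
      Complex.exp (-2 * (Real.pi : ℂ) * Complex.I / (p : ℂ)) ^ ((j : ℕ) * (k : ℕ))

/-- The block diagonal matrix `diag(Â_{::1}, …, Â_{::p})`. -/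
def fftBD {α β : Type*} (A : Fin p → Matrix α β ℝ) : Matrix (Fin p × α) (Fin p × β) ℂ :=
  Matrix.of fun ki lj => if ki.1 = lj.1 then fft A ki.1 ki.2 lj.2 else 0

/-- The square of the smallest nonzero singular value of `M`, i.e. the smallest nonzero
eigenvalue of `Mᴴ * M`. -/
def sigmaMinSq {α β : Type*} [Fintype α] [Fintype β] (M : Matrix α β ℂ) : ℝ :=
  sInf {t : ℝ | t ≠ 0 ∧ ∃ v : β → ℂ, v ≠ 0 ∧ (Mᴴ * M) *ᵥ v = (t : ℂ) • v}


theorem tprod_apply {α β γ : Type*} [Fintype β] (A : Fin p → Matrix α β ℝ)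
    (B : Fin p → Matrix β γ ℝ) (s : Fin p) (i : α) (j : γ) :
    tprod A B s i j = ∑ t, ∑ b, A (s - t) i b * B t b j := by
  simp [tprod, Matrix.sum_apply, Matrix.mul_apply]

theorem tprod_assoc {α β γ δ : Type*} [Fintype β] [Fintype γ] [NeZero p]
    (A : Fin p → Matrix α β ℝ) (B : Fin p → Matrix β γ ℝ) (C : Fin p → Matrix γ δ ℝ) :
    tprod (tprod A B) C = tprod A (tprod B C) := by
  funext s
  simp only [tprod, Matrix.sum_mul, Matrix.mul_sum]
  conv_rhs => rw [Finset.sum_comm]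
  refine Finset.sum_congr rfl fun t _ => ?_
  refine Fintype.sum_equiv (Equiv.addRight t) _ _ fun u => ?_
  simp only [Equiv.coe_addRight, add_sub_cancel_right, Matrix.mul_assoc, sub_sub, add_comm t u]

theorem tId_tprod {n : ℕ} {γ : Type*} [NeZero p] (B : Fin p → Matrix (Fin n) γ ℝ) :
    tprod (tId n p) B = B := by
  funext s
  rw [tprod, Fintype.sum_eq_single s fun t ht => ?_]
  · simp [tId]
  · simp [tId, sub_eq_zero, ht.symm]

theorem tprod_tId {n : ℕ} {α : Type*} [NeZero p] (B : Fin p → Matrix α (Fin n) ℝ) :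
    tprod B (tId n p) = B := by
  funext s
  rw [tprod, Fintype.sum_eq_single 0 fun t ht => ?_]
  · simp [tId]
  · simp [tId, ht]

theorem tId_nonneg (n : ℕ) [NeZero p] : Nonneg (tId n p) := by
  intro k i j
  unfold tId
  split_ifs
  · rw [Matrix.one_apply]; split_ifs <;> norm_num
  · simp

theorem tprod_row_congr {α α' β γ : Type*} [Fintype β] {A : Fin p → Matrix α β ℝ}
    {A' : Fin p → Matrix α' β ℝ} (B : Fin p → Matrix β γ ℝ) {i : α} {i' : α'}
    (h : ∀ k b, A k i b = A' k i' b) (s : Fin p) (j : γ) :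
    tprod A B s i j = tprod A' B s i' j := by
  simp only [tprod_apply, h]

theorem tprod_col_congr {α β γ γ' : Type*} [Fintype β] (A : Fin p → Matrix α β ℝ)
    {B : Fin p → Matrix β γ ℝ} {B' : Fin p → Matrix β γ' ℝ} {j : γ} {j' : γ'}
    (h : ∀ k b, B k b j = B' k b j') (s : Fin p) (i : α) :
    tprod A B s i j = tprod A B' s i j' := by
  simp only [tprod_apply, h]

open Classical in
/-- The tensor whose row `ι a` is row `a` of the identity tensor, and whose remaining rows are
those of `M`. -/
def rowExtend {m r : ℕ} [NeZero p] (ι : Fin r → Fin m) (M : Fin p → Matrix (Fin m) (Fin r) ℝ) :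
    Fin p → Matrix (Fin m) (Fin r) ℝ :=
  fun k i b => if h : i ∈ Set.range ι then tId r p k h.choose b else M k i b

theorem rowExtend_range {m r : ℕ} [NeZero p] {ι : Fin r → Fin m} (hι : Function.Injective ι)
    (M : Fin p → Matrix (Fin m) (Fin r) ℝ) (k : Fin p) (a b : Fin r) :
    rowExtend ι M k (ι a) b = tId r p k a b := by
  have h : ι a ∈ Set.range ι := ⟨a, rfl⟩
  rw [rowExtend, dif_pos h, hι h.choose_spec]

theorem rowExtend_notMem {m r : ℕ} [NeZero p] {ι : Fin r → Fin m}
    (M : Fin p → Matrix (Fin m) (Fin r) ℝ) (k : Fin p) {i : Fin m} (b : Fin r)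
    (h : i ∉ Set.range ι) : rowExtend ι M k i b = M k i b := by
  rw [rowExtend, dif_neg h]

open Classical in
/-- The tensor whose column `κ b` is column `b` of the identity tensor, and whose remaining
columns are those of `M`. -/
def colExtend {n r : ℕ} [NeZero p] (κ : Fin r → Fin n) (M : Fin p → Matrix (Fin r) (Fin n) ℝ) :
    Fin p → Matrix (Fin r) (Fin n) ℝ :=
  fun k b j => if h : j ∈ Set.range κ then tId r p k b h.choose else M k b j

theorem colExtend_range {n r : ℕ} [NeZero p] {κ : Fin r → Fin n} (hκ : Function.Injective κ)
    (M : Fin p → Matrix (Fin r) (Fin n) ℝ) (k : Fin p) (b c : Fin r) :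
    colExtend κ M k b (κ c) = tId r p k b c := by
  have h : κ c ∈ Set.range κ := ⟨c, rfl⟩
  rw [colExtend, dif_pos h, hκ h.choose_spec]

theorem colExtend_notMem {n r : ℕ} [NeZero p] {κ : Fin r → Fin n}
    (M : Fin p → Matrix (Fin r) (Fin n) ℝ) (k : Fin p) (b : Fin r) {j : Fin n}
    (h : j ∉ Set.range κ) : colExtend κ M k b j = M k b j := by
  rw [colExtend, dif_neg h]

/-- Theorem 3.5 (ii): if `A` admits a t-CUR decomposition
`A = A_{:J:} * G * A_{I::}` with `G` an inner inverse of the core `A_{IJ:}`, and the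
tensors `A_{I^c J:} * G` and `G * A_{I J^c:}` are entrywise nonnegative, then `A` is
co-(r1,r2)-separable with core `A_{IJ:}`. -/
theorem coseparable_of_tCUR {m n p r1 r2 : ℕ} [NeZero p]
    (A : Fin p → Matrix (Fin m) (Fin n) ℝ) (hA : Nonneg A)
    (ι : Fin r1 → Fin m) (κ : Fin r2 → Fin n)
    (hι : Function.Injective ι) (hκ : Function.Injective κ)
    (G : Fin p → Matrix (Fin r2) (Fin r1) ℝ)
    (hG : tprod (tprod (coreSub ι κ A) G) (coreSub ι κ A) = coreSub ι κ A)
    (hCUR : A = tprod (tprod (csub κ A) G) (rsub ι A))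
    (hMnn : Nonneg (tprod
      (coreSub (fun i : {i : Fin m // i ∉ Set.range ι} => (i : Fin m)) κ A) G))
    (hHnn : Nonneg (tprod G
      (coreSub ι (fun j : {j : Fin n // j ∉ Set.range κ} => (j : Fin n)) A))) :
    CoseparableWithCore ι κ A := by
  have hC : tprod (rowExtend ι (tprod (csub κ A) G)) (coreSub ι κ A) = csub κ A := by
    funext s i b
    by_cases hi : i ∈ Set.range ι
    · obtain ⟨a, rfl⟩ := hi
      rw [tprod_row_congr _ fun k b => rowExtend_range hι _ k a b, tId_tprod]
      rfl
    · rw [tprod_row_congr _ fun k b => rowExtend_notMem _ k b hi]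
      refine Eq.trans ?_ (congrFun (congrFun (congrFun hCUR s) i) (κ b)).symm
      exact tprod_col_congr _ (B := coreSub ι κ A) (B' := rsub ι A) (fun _ _ => rfl) s i
  refine ⟨rowExtend ι (tprod (csub κ A) G), colExtend κ (tprod G (rsub ι A)),
    fun k i a => ?_, fun k b j => ?_, ?_, ?_, ?_⟩
  · by_cases hi : i ∈ Set.range ι
    · obtain ⟨c, rfl⟩ := hi
      rw [rowExtend_range hι]
      exact tId_nonneg r1 k c a
    · rw [rowExtend_notMem _ k a hi]
      exact (hMnn k ⟨i, hi⟩ a).trans_eq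
        (tprod_row_congr G (fun _ _ => by rfl) k a)
  · by_cases hj : j ∈ Set.range κ
    · obtain ⟨c, rfl⟩ := hj
      rw [colExtend_range hκ]
      exact tId_nonneg r2 k b c
    · rw [colExtend_notMem _ k b hj]
      exact (hHnn k b ⟨j, hj⟩).trans_eq
        (tprod_col_congr G (fun _ _ => by rfl) k b)
  · funext k a b
    exact rowExtend_range hι _ k a b
  · funext k b c
    exact colExtend_range hκ _ k b c
  · rw [hC]
    funext s i j
    by_cases hj : j ∈ Set.range κ
    · obtain ⟨c, rfl⟩ := hj
      rw [tprod_col_congr _ fun k b => colExtend_range hκ _ k b c, tprod_tId]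
      rfl
    · rw [tprod_col_congr _ fun k b => colExtend_notMem _ k b hj, ← tprod_assoc, ← hCUR]

end

end CoSepNTF
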